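/- Let (Q,P) be a weakly quasi-lattice ordered group and let Λ be a P-graph with FA(Λ) ≠ ∅. Then the path space PS(Λ) and the boundary-path space BPS(Λ) are Hausdorff and each has a countable basis consisting of compact sets; moreover PS(Λ) is open in ℱΛ. -/

import Mathlib

set_option autoImplicit false

/-- The topology on the power set `Set α` obtained by identifying it with the
product `∏ _ : α, Prop` where each (two-point) factor `Prop` carries the
discrete topology. -/
instance powersetTopology (α : Type) : TopologicalSpace (Set α) :=
  @Pi.topologicalSpace α (fun _ => Prop) (fun _ => ⊥)

/-- The cylinder `Z(K₁;K₂) = {x : K₁ ⊆ x ⊆ K₂ᶜ}`. -/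
def cylinder {α : Type} (K₁ K₂ : Set α) : Set (Set α) :=
  {x | K₁ ⊆ x ∧ x ⊆ K₂ᶜ}

/-- The relation `p ≤ r` iff `p * q = r` for some `q ∈ P`. -/
def Submonoid.leftLE {Q : Type} [Group Q] (P : Submonoid Q) (p r : Q) : Prop :=
  ∃ q ∈ P, p * q = r

/-- A weakly quasi-lattice ordered group `(Q,P)`: a group `Q` together with a
subsemigroup `P` containing the unit with `P ∩ P⁻¹ = {e}`, such that any two
elements of `P` with a common upper bound (for `leftLE`) have a least common
upper bound. -/
structure WQLO (Q : Type) [Group Q] where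
  P : Submonoid Q
  inter_inv : ∀ p ∈ P, p⁻¹ ∈ P → p = 1
  lub : ∀ a ∈ P, ∀ b ∈ P, (∃ c ∈ P, P.leftLE a c ∧ P.leftLE b c) →
    ∃ l ∈ P, P.leftLE a l ∧ P.leftLE b l ∧
      ∀ c ∈ P, P.leftLE a c → P.leftLE b c → P.leftLE l c

/-- A (discrete) `P`-graph: a countable small category, presented by its set of
morphisms `Λ` with range map `r`, source map `s` and a composition `mul`
(constrained by the axioms only on composable pairs, i.e. when `s μ = r ν`),
together with a degree functor `d : Λ → P` satisfying the unique factorisation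
property. The units of `Λ` are exactly the elements of the form `r lam`. -/
structure PGraph (Q : Type) [Group Q] (W : WQLO Q) where
  Λ : Type
  countable : Countable Λ
  r : Λ → Λ
  s : Λ → Λ
  mul : Λ → Λ → Λ
  d : Λ → Q
  d_mem : ∀ lam, d lam ∈ W.P
  s_r : ∀ lam, s (r lam) = r lam
  r_r : ∀ lam, r (r lam) = r lam
  s_s : ∀ lam, s (s lam) = s lam
  r_s : ∀ lam, r (s lam) = s lam
  id_mul : ∀ lam, mul (r lam) lam = lam
  mul_id : ∀ lam, mul lam (s lam) = lam
  r_mul : ∀ mu nu, s mu = r nu → r (mul mu nu) = r mu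
  s_mul : ∀ mu nu, s mu = r nu → s (mul mu nu) = s nu
  mul_assoc : ∀ mu nu k, s mu = r nu → s nu = r k →
    mul (mul mu nu) k = mul mu (mul nu k)
  d_unit : ∀ lam, d (r lam) = 1
  d_mul : ∀ mu nu, s mu = r nu → d (mul mu nu) = d mu * d nu
  factor : ∀ lam, ∀ p ∈ W.P, ∀ q ∈ W.P, d lam = p * q →
    ∃! mn : Λ × Λ, s mn.1 = r mn.2 ∧ mul mn.1 mn.2 = lam ∧ d mn.1 = p ∧ d mn.2 = q

namespace PGraph

variable {Q : Type} [Group Q] {W : WQLO Q} (G : PGraph Q W)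

/-- `λΛ = {λμ : μ ∈ Λ, s λ = r μ}`. -/
def cone (lam : G.Λ) : Set G.Λ :=
  {x | ∃ mu, G.s lam = G.r mu ∧ x = G.mul lam mu}

/-- `λE = {λμ : μ ∈ E, s λ = r μ}`. -/
def coneSet (lam : G.Λ) (E : Set G.Λ) : Set G.Λ :=
  {x | ∃ mu ∈ E, G.s lam = G.r mu ∧ x = G.mul lam mu}

/-- `Λ` is finitely aligned at the pair `(μ,ν)`. -/
def FinAlignedAtPair (mu nu : G.Λ) : Prop :=
  ∃ J : Finset G.Λ, G.cone mu ∩ G.cone nu = ⋃ lam ∈ (J : Set G.Λ), G.cone lam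

/-- `Λ` is finitely aligned at `λ`. -/
def FinAlignedAt (lam : G.Λ) : Prop :=
  ∀ mu ∈ G.cone lam, ∀ nu : G.Λ, G.FinAlignedAtPair mu nu

/-- The finitely aligned part `FA(Λ)`. -/
def FA : Set G.Λ := {lam | G.FinAlignedAt lam}

/-- `FAr(Λ) = FA(Λ) ∪ r(FA(Λ))`. -/
def FAr : Set G.Λ := G.FA ∪ G.r '' G.FA

/-- `μ ≼ λ` iff `μν = λ` for some `ν`. -/
def pre (mu lam : G.Λ) : Prop :=
  ∃ nu, G.s mu = G.r nu ∧ G.mul mu nu = lam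

/-- A filter: a nonempty, hereditary and directed subset of `Λ`. -/
def IsFilter (x : Set G.Λ) : Prop :=
  x.Nonempty ∧ (∀ lam mu, G.pre lam mu → mu ∈ x → lam ∈ x) ∧
    ∀ mu ∈ x, ∀ nu ∈ x, ∃ lam ∈ x, G.pre mu lam ∧ G.pre nu lam

/-- The space `ℱΛ` of filters, with the subspace topology from `𝒫(Λ)`. -/
abbrev FilterSpace := {x : Set G.Λ // G.IsFilter x}

/-- `Z_{ℱΛ}(μ;K) = {x ∈ ℱΛ : μ ∈ x ⊆ Λ∖K}`. -/
def Zf (mu : G.Λ) (K : Set G.Λ) : Set G.FilterSpace :=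
  {x | mu ∈ x.1 ∧ x.1 ⊆ Kᶜ}

/-- An ultrafilter: a filter maximal with respect to inclusion. -/
def IsUltrafilter (x : Set G.Λ) : Prop :=
  G.IsFilter x ∧ ∀ y, G.IsFilter y → x ⊆ y → x = y

/-- The path space `PS(Λ)`: filters meeting `FA(Λ)` (as a set of subsets). -/
def PS : Set (Set G.Λ) := {x | G.IsFilter x ∧ (x ∩ G.FA).Nonempty}

/-- The path space as a topological space (subspace of `𝒫(Λ)`). -/
abbrev PSpace := {x : Set G.Λ // x ∈ G.PS}

/-- The boundary-path space: the closure in `PS(Λ)` of the set of ultrafilters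
lying in `PS(Λ)`. -/
def BPS : Set G.PSpace := closure {x : G.PSpace | G.IsUltrafilter x.1}

abbrev BPSpace := {x : G.PSpace // x ∈ G.BPS}

/-- The left shift `λ⁻¹·x = {μ : λμ ∈ x}`. -/
def lshift (lam : G.Λ) (x : Set G.Λ) : Set G.Λ :=
  {mu | G.s lam = G.r mu ∧ G.mul lam mu ∈ x}

/-- The right shift `λ·x = {ζ : ζ ≼ λμ for some μ ∈ x}`. -/
def rshift (lam : G.Λ) (x : Set G.Λ) : Set G.Λ :=
  {z | ∃ mu ∈ x, G.s lam = G.r mu ∧ G.pre z (G.mul lam mu)}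

/-- The action `x·m`: the left shift of `x` by the unique element of
`x ∩ Λ^m` (when it exists). -/
def act (x : Set G.Λ) (m : Q) : Set G.Λ :=
  ⋃ lam ∈ {l ∈ x | G.d l = m}, G.lshift lam x

/-- The domain `D_m = {x ∈ PS(Λ) : x ∩ Λ^m ≠ ∅}` of `T_m`. -/
def Dom (m : Q) : Set (Set G.Λ) := {x ∈ G.PS | ∃ l ∈ x, G.d l = m}

/-- The range `R_m = {x·m : x ∈ D_m}` of `T_m`. -/
def Ran (m : Q) : Set (Set G.Λ) := {y | ∃ x ∈ G.Dom m, G.act x m = y}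

end PGraph

section Powerset

variable (α : Type)

instance powerset_t2Space : T2Space (Set α) := by
  let : TopologicalSpace Prop := ⊥
  have : DiscreteTopology Prop := ⟨rfl⟩
  exact inferInstanceAs (T2Space (α → Prop))

instance powerset_compactSpace : CompactSpace (Set α) := by
  let : TopologicalSpace Prop := ⊥
  exact inferInstanceAs (CompactSpace (α → Prop))

instance powerset_totallyDisconnectedSpace : TotallyDisconnectedSpace (Set α) := by
  let : TopologicalSpace Prop := ⊥
  have : DiscreteTopology Prop := ⟨rfl⟩
  exact inferInstanceAs (TotallyDisconnectedSpace (α → Prop))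

instance powerset_secondCountableTopology [Countable α] :
    SecondCountableTopology (Set α) := by
  let : TopologicalSpace Prop := ⊥
  have : DiscreteTopology Prop := ⟨rfl⟩
  exact inferInstanceAs (SecondCountableTopology (α → Prop))

variable {α}

theorem isClopen_setOf_mem (a : α) : IsClopen {x : Set α | a ∈ x} := by
  let : TopologicalSpace Prop := ⊥
  have : DiscreteTopology Prop := ⟨rfl⟩
  exact (isClopen_discrete {p : Prop | p}).preimage (continuous_apply a)

end Powerset

/-- A second countable, locally compact, totally disconnected Hausdorff space has a countable
basis of compact sets. -/
theorem exists_countable_basis_isCompact (X : Type) [TopologicalSpace X] [T2Space X]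
    [LocallyCompactSpace X] [TotallyDisconnectedSpace X] [SecondCountableTopology X] :
    ∃ B : Set (Set X), B.Countable ∧
      TopologicalSpace.IsTopologicalBasis B ∧ ∀ U ∈ B, IsCompact U := by
  have hbasis : TopologicalSpace.IsTopologicalBasis {U : Set X | IsOpen U ∧ IsCompact U} := by
    refine TopologicalSpace.isTopologicalBasis_of_isOpen_of_nhds (fun U hU => hU.1) ?_
    intro a U ha hU
    obtain ⟨K, hK, haK, hKU⟩ := exists_compact_subset hU ha
    obtain ⟨V, hV, haV, hVK⟩ :=
      (loc_compact_Haus_tot_disc_of_zero_dim (H := X)).exists_subset_of_mem_open haK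
        isOpen_interior
    have hVK' : V ⊆ K := hVK.trans interior_subset
    exact ⟨V, ⟨hV.isOpen, hK.of_isClosed_subset hV.isClosed hVK'⟩, haV, hVK'.trans hKU⟩
  obtain ⟨B, hB, hBc, hBb⟩ := hbasis.exists_countable
  exact ⟨B, hBc, hBb, fun U hU => (hB hU).2⟩

namespace PGraph

variable {Q : Type} [Group Q] {W : WQLO Q} (G : PGraph Q W)

theorem mem_cone_iff_pre {mu lam : G.Λ} : lam ∈ G.cone mu ↔ G.pre mu lam := by
  simp [cone, pre, eq_comm]

theorem mem_cone_self (lam : G.Λ) : lam ∈ G.cone lam :=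
  ⟨G.s lam, (G.r_s lam).symm, (G.mul_id lam).symm⟩

variable {G}

/-- At a pair where `Λ` is finitely aligned, finitely many common extensions witness
directedness for every filter. -/
theorem FinAlignedAtPair.exists_finset {mu nu : G.Λ} (h : G.FinAlignedAtPair mu nu) :
    ∃ J : Finset G.Λ, (∀ k ∈ J, G.pre mu k ∧ G.pre nu k) ∧
      ∀ x, G.IsFilter x → mu ∈ x → nu ∈ x → ∃ k ∈ J, k ∈ x := by
  obtain ⟨J, hJ⟩ := h
  refine ⟨J, fun k hk => ?_, fun x hx hmu hnu => ?_⟩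
  · have : k ∈ G.cone mu ∩ G.cone nu := by
      rw [hJ]
      exact Set.mem_biUnion hk (G.mem_cone_self k)
    simpa only [Set.mem_inter_iff, mem_cone_iff_pre] using this
  · obtain ⟨lam, hlam, hmul, hnul⟩ := hx.2.2 mu hmu nu hnu
    have : lam ∈ G.cone mu ∩ G.cone nu :=
      ⟨G.mem_cone_iff_pre.2 hmul, G.mem_cone_iff_pre.2 hnul⟩
    rw [hJ] at this
    obtain ⟨k, hk, hkl⟩ := Set.mem_iUnion₂.1 this
    exact ⟨k, hk, hx.2.1 k lam (G.mem_cone_iff_pre.1 hkl) hlam⟩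

theorem pre.trans {a b c : G.Λ} (hab : G.pre a b) (hbc : G.pre b c) : G.pre a c := by
  obtain ⟨m, hm, rfl⟩ := hab
  obtain ⟨n, hn, rfl⟩ := hbc
  rw [G.s_mul a m hm] at hn
  exact ⟨G.mul m n, by rw [G.r_mul m n hn, hm], (G.mul_assoc a m n hm hn).symm⟩

/-- The filters containing a given element of `FA(Λ)` form a closed subset of `𝒫(Λ)`. -/
theorem isClosed_setOf_isFilter_mem {lam : G.Λ} (hlam : lam ∈ G.FA) :
    IsClosed {x : Set G.Λ | G.IsFilter x ∧ lam ∈ x} := by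
  have key : ∀ mu nu, ∃ J : Finset G.Λ, G.pre lam mu →
      (∀ k ∈ J, G.pre mu k ∧ G.pre nu k) ∧
      ∀ x, G.IsFilter x → mu ∈ x → nu ∈ x → ∃ k ∈ J, k ∈ x := by
    intro mu nu
    by_cases h : G.pre lam mu
    · obtain ⟨J, hJ⟩ := (hlam mu (G.mem_cone_iff_pre.2 h) nu).exists_finset
      exact ⟨J, fun _ => hJ⟩
    · exact ⟨∅, fun h' => absurd h' h⟩
  choose J hJ using key
  have heq : {x : Set G.Λ | G.IsFilter x ∧ lam ∈ x} = {x | lam ∈ x} ∩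
      ((⋂ a, ⋂ b, ⋂ _ : G.pre a b, ({x | b ∈ x}ᶜ ∪ {x | a ∈ x})) ∩
      ⋂ mu, ⋂ nu, ⋂ _ : G.pre lam mu,
        ({x | mu ∈ x}ᶜ ∪ ({x | nu ∈ x}ᶜ ∪ ⋃ k ∈ J mu nu, {x | k ∈ x}))) := by
    ext x
    simp only [Set.mem_inter_iff, Set.mem_iInter, Set.mem_union, Set.mem_compl_iff,
      Set.mem_ofPred_eq, Set.mem_iUnion, ← imp_iff_not_or, exists_prop]
    constructor
    · rintro ⟨hx, hl⟩
      exact ⟨hl, hx.2.1, fun mu nu h => (hJ mu nu h).2 x hx⟩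
    · rintro ⟨hl, hher, hdir⟩
      refine ⟨⟨⟨lam, hl⟩, hher, fun mu hmu nu hnu => ?_⟩, hl⟩
      have hll : G.pre lam lam := G.mem_cone_iff_pre.1 (G.mem_cone_self lam)
      obtain ⟨k, hk, hkx⟩ := hdir lam mu hll hl hmu
      obtain ⟨hlk, hmk⟩ := (hJ lam mu hll).1 k hk
      obtain ⟨k', hk', hkx'⟩ := hdir k nu hlk hkx hnu
      obtain ⟨hkk', hnk'⟩ := (hJ k nu hlk).1 k' hk'
      exact ⟨k', hkx', hmk.trans hkk', hnk'⟩
  rw [heq]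
  have hcl (a : G.Λ) : IsClosed {x : Set G.Λ | a ∈ x} := (isClopen_setOf_mem a).isClosed
  have hcl' (a : G.Λ) : IsClosed {x : Set G.Λ | a ∈ x}ᶜ := (isClopen_setOf_mem a).compl.isClosed
  refine (hcl lam).inter (IsClosed.inter ?_ ?_)
  · exact isClosed_iInter fun a => isClosed_iInter fun b => isClosed_iInter fun _ =>
      (hcl' b).union (hcl a)
  · exact isClosed_iInter fun a => isClosed_iInter fun b => isClosed_iInter fun _ =>
      (hcl' a).union ((hcl' b).union (isClosed_biUnion_finset fun k _ => hcl k))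

instance : LocallyCompactSpace G.PSpace := by
  have : WeaklyLocallyCompactSpace G.PSpace := by
    refine ⟨fun ⟨x, hx⟩ => ?_⟩
    obtain ⟨lam, hlx, hlam⟩ := hx.2
    refine ⟨{y | lam ∈ y.1}, ?_,
      ((isClopen_setOf_mem lam).isOpen.preimage continuous_subtype_val).mem_nhds hlx⟩
    rw [Subtype.isCompact_iff]
    convert (isClosed_setOf_isFilter_mem hlam).isCompact
    ext y
    constructor
    · rintro ⟨z, hz, rfl⟩
      exact ⟨z.2.1, hz⟩
    · rintro ⟨hy, hly⟩
      exact ⟨⟨y, hy, lam, hly, hlam⟩, hly, rfl⟩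
  infer_instance

variable (G) in
theorem isOpen_setOf_mem_PS : IsOpen {x : G.FilterSpace | x.1 ∈ G.PS} := by
  have heq : {x : G.FilterSpace | x.1 ∈ G.PS} =
      ⋃ lam ∈ G.FA, Subtype.val ⁻¹' {x : Set G.Λ | lam ∈ x} := by
    ext x
    simp [PS, x.2, Set.Nonempty, and_comm]
  rw [heq]
  exact isOpen_biUnion fun lam _ =>
    (isClopen_setOf_mem lam).isOpen.preimage continuous_subtype_val

end PGraph

/-- If `FA(Λ) ≠ ∅` then the path space `PS(Λ)` and the boundary-path space
`BPS(Λ)` are Hausdorff with countable bases of compact sets, and `PS(Λ)` is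
open in `ℱΛ`. -/
theorem statement8 {Q : Type} [Group Q] {W : WQLO Q} (G : PGraph Q W)
    (hne : G.FA.Nonempty) :
    T2Space G.PSpace ∧
    (∃ B : Set (Set G.PSpace), B.Countable ∧
      TopologicalSpace.IsTopologicalBasis B ∧ ∀ U ∈ B, IsCompact U) ∧
    T2Space G.BPSpace ∧
    (∃ B : Set (Set G.BPSpace), B.Countable ∧
      TopologicalSpace.IsTopologicalBasis B ∧ ∀ U ∈ B, IsCompact U) ∧
    IsOpen {x : G.FilterSpace | x.1 ∈ G.PS} := by
  have := G.countable
  have : LocallyCompactSpace G.BPSpace := isClosed_closure.locallyCompactSpace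
  exact ⟨inferInstance, exists_countable_basis_isCompact _, inferInstance,
    exists_countable_basis_isCompact _, G.isOpen_setOf_mem_PS⟩
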